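/- Let P = {I_1, …, I_m}, Q = {J_1, …, J_n}, and S = {K_1, …, K_r} be partitions in a set A whose supports R(P), R(Q), R(S) are pairwise disjoint, and fix indices a (1 ≤ a ≤ m) and c (1 ≤ c ≤ n). Then the assignment (ι, μ_J) ↦ (ι', μ') — determined by μ' = μ_J|_{J_c}, ι'|_{I_a \ ι⁻¹(J_c)} = ι, and ι'(x) = μ_J(x) for x ∈ ι⁻¹(J_c) — is a bijection between pairs (ι : I_a → Q, μ_J : J_c ∪ ι⁻¹(J_c) → S) and pairs (μ' : J_c → S, ι' : I_a → members of Q ∘_c^{μ'} S), and it satisfies (P ∘_a^ι Q) ∘^{μ_J} S = P ∘_a^{ι'} (Q ∘_c^{μ'} S), where the insertion ∘^{μ_J} is performed at the member J_c ∪ ι⁻¹(J_c) of P ∘_a^ι Q. -/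

import Mathlib

namespace PartitionOps

variable {α : Type*} [DecidableEq α]

/-- The support `R(P)` of a collection of finite sets: the union of its members. -/
def supp (P : Finset (Finset α)) : Finset α := P.sup id

/-- A partition in `A`: a finite collection of pairwise disjoint nonempty finite sets. -/
def IsPartition (P : Finset (Finset α)) : Prop :=
  (∀ I ∈ P, I.Nonempty) ∧ ∀ I ∈ P, ∀ I' ∈ P, I ≠ I' → Disjoint I I'

/-- The restriction `P_(B) = { I ∩ B : I ∈ P, I ∩ B ≠ ∅ }`. -/
def restrict (P : Finset (Finset α)) (B : Finset α) : Finset (Finset α) :=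
  (P.filter fun I => (I ∩ B).Nonempty).image (· ∩ B)

/-- `R_{P,B}`: the union of the members of `P` meeting `B`. -/
def RB (P : Finset (Finset α)) (B : Finset α) : Finset α :=
  (P.filter fun I => (I ∩ B).Nonempty).sup id

/-- The quotient `P / P_(B)`: the members of `P` disjoint from `B`, together with
`R_{P,B} \ B` (omitted when empty). -/
def quot (P : Finset (Finset α)) (B : Finset α) : Finset (Finset α) :=
  (insert (RB P B \ B) (P.filter fun I => I ∩ B = ∅)).erase ∅

/-- Quotient of `P` by a partition `Q` (meaningful when `Q` coincides with the
restriction of `P` to the support of `Q`): `P / Q := P / P_(R(Q))`. -/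
def quotBy (P Q : Finset (Finset α)) : Finset (Finset α) := quot P (supp Q)

/-- The preimage `ι⁻¹(J) ⊆ B` of a member `J` under a map `ι` defined on `B`. -/
def fiber (B : Finset α) (f : {x // x ∈ B} → Finset α) (J : Finset α) : Finset α :=
  (B.attach.filter fun x => f x = J).image Subtype.val

/-- The insertion `P ∘ₐ^ι Q` of `Q` into `P` at the member `Ia` via `ι : Ia → Q`:
remove `Ia` from `P` and add the sets `J ∪ ι⁻¹(J)` for the members `J` of `Q`. -/
def ins (P : Finset (Finset α)) (Ia : Finset α) (Q : Finset (Finset α))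
    (ι : {x // x ∈ Ia} → {J // J ∈ Q}) : Finset (Finset α) :=
  P.erase Ia ∪ Q.image fun J => J ∪ fiber Ia (fun x => (ι x : Finset α)) J

theorem mem_fiber' {B : Finset α} {f : {x // x ∈ B} → Finset α} {J : Finset α} {x : α} :
    x ∈ fiber B f J ↔ ∃ h : x ∈ B, f ⟨x, h⟩ = J := by
  simp [fiber]

theorem mem_ins' {P : Finset (Finset α)} {Ia : Finset α} {Q : Finset (Finset α)}
    {ι : {x // x ∈ Ia} → {J // J ∈ Q}} {T : Finset α} :
    T ∈ ins P Ia Q ι ↔ (T ≠ Ia ∧ T ∈ P) ∨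
      ∃ J ∈ Q, J ∪ fiber Ia (fun x => (ι x : Finset α)) J = T := by
  simp [ins]

theorem not_mem_of_disj {P Q : Finset (Finset α)} (h : Disjoint (supp P) (supp Q))
    {I J : Finset α} (hI : I ∈ P) (hJ : J ∈ Q) {z : α} (hz : z ∈ I) (hz' : z ∈ J) : False := by
  have h1 : z ∈ supp P := Finset.mem_sup.2 ⟨I, hI, hz⟩
  have h2 : z ∈ supp Q := Finset.mem_sup.2 ⟨J, hJ, hz'⟩
  exact Finset.disjoint_left.1 h h1 h2

theorem part_eq {P : Finset (Finset α)} (h : IsPartition P)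
    {I J : Finset α} (hI : I ∈ P) (hJ : J ∈ P) {z : α} (hz : z ∈ I) (hz' : z ∈ J) : I = J := by
  by_contra hne
  exact Finset.disjoint_left.1 (h.2 I hI J hJ hne) hz hz'

theorem ne_union {Q S : Finset (Finset α)} (hS : IsPartition S)
    (hQS : Disjoint (supp Q) (supp S)) {J K : Finset α} (hJ : J ∈ Q) (hK : K ∈ S)
    (X : Finset α) : J ≠ K ∪ X := by
  rintro rfl
  obtain ⟨z, hz⟩ := hS.1 K hK
  exact not_mem_of_disj hQS hJ hK (Finset.mem_union_left _ hz) hz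

theorem union_inj {Q S : Finset (Finset α)} (hS : IsPartition S)
    (hQS : Disjoint (supp Q) (supp S)) {Jc K K' : Finset α} (hJ : Jc ∈ Q) (hK : K ∈ S)
    (hK' : K' ∈ S) {f g : {x // x ∈ Jc} → Finset α}
    (h : K ∪ fiber Jc f K = K' ∪ fiber Jc g K') : K = K' := by
  obtain ⟨z, hz⟩ := hS.1 K hK
  have hz2 : z ∈ K' ∪ fiber Jc g K' := h ▸ Finset.mem_union_left _ hz
  rcases Finset.mem_union.1 hz2 with h1 | h1
  · exact part_eq hS hK hK' hz h1
  · obtain ⟨h2, -⟩ := mem_fiber'.1 h1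
    exact (not_mem_of_disj hQS hJ hK h2 hz).elim

theorem src_ext {Q S : Finset (Finset α)} {Ia Jc : Finset α}
    (p q : Σ ι : {x // x ∈ Ia} → {J // J ∈ Q},
            ({y // y ∈ Jc ∪ fiber Ia (fun x => (ι x : Finset α)) Jc} → {Kk // Kk ∈ S}))
    (h1 : ∀ x, p.1 x = q.1 x) (h2 : ∀ y hy hy', p.2 ⟨y, hy⟩ = q.2 ⟨y, hy'⟩) : p = q := by
  obtain ⟨a, b⟩ := p
  obtain ⟨c, d⟩ := q
  obtain rfl : a = c := funext h1
  congr 1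
  funext ⟨y, hy⟩
  exact h2 y hy hy

theorem tgt_ext {Q S : Finset (Finset α)} {Ia Jc : Finset α}
    (p q : Σ μ' : {y // y ∈ Jc} → {Kk // Kk ∈ S},
            ({x // x ∈ Ia} → {J // J ∈ ins Q Jc S μ'}))
    (h1 : ∀ x, p.1 x = q.1 x) (h2 : ∀ x, (p.2 x : Finset α) = q.2 x) : p = q := by
  obtain ⟨a, b⟩ := p
  obtain ⟨c, d⟩ := q
  obtain rfl : a = c := funext h1
  congr 1
  funext x
  exact Subtype.ext (h2 x)

theorem mem_second {Q : Finset (Finset α)} {Ia Jc : Finset α}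
    {ι : {x // x ∈ Ia} → {J // J ∈ Q}} {x : {x // x ∈ Ia}} (h : (ι x : Finset α) = Jc) :
    (x : α) ∈ Jc ∪ fiber Ia (fun z => (ι z : Finset α)) Jc :=
  Finset.mem_union_right _ (mem_fiber'.2 ⟨x.2, h⟩)

/-- The forward assignment. -/
def fwd (Q S : Finset (Finset α)) (Ia Jc : Finset α)
    (p : Σ ι : {x // x ∈ Ia} → {J // J ∈ Q},
      ({y // y ∈ Jc ∪ fiber Ia (fun x => (ι x : Finset α)) Jc} → {Kk // Kk ∈ S})) :
    Σ μ' : {y // y ∈ Jc} → {Kk // Kk ∈ S}, ({x // x ∈ Ia} → {J // J ∈ ins Q Jc S μ'}) :=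
  ⟨fun y => p.2 ⟨y, Finset.mem_union_left _ y.2⟩, fun x =>
    if h : (p.1 x : Finset α) = Jc then
      ⟨(p.2 ⟨x, mem_second h⟩ : Finset α) ∪
        fiber Jc (fun y => (p.2 ⟨y, Finset.mem_union_left _ y.2⟩ : Finset α))
          (p.2 ⟨x, mem_second h⟩ : Finset α),
        mem_ins'.2 (Or.inr ⟨_, (p.2 ⟨x, mem_second h⟩).2, rfl⟩)⟩
    else ⟨p.1 x, mem_ins'.2 (Or.inl ⟨h, (p.1 x).2⟩)⟩⟩

theorem fwd_pos (Q S : Finset (Finset α)) (Ia Jc : Finset α)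
    (p : Σ ι : {x // x ∈ Ia} → {J // J ∈ Q},
      ({y // y ∈ Jc ∪ fiber Ia (fun x => (ι x : Finset α)) Jc} → {Kk // Kk ∈ S}))
    (x : {x // x ∈ Ia}) (h : (p.1 x : Finset α) = Jc) :
    ((fwd Q S Ia Jc p).2 x : Finset α) = (p.2 ⟨x, mem_second h⟩ : Finset α) ∪
        fiber Jc (fun y => ((fwd Q S Ia Jc p).1 y : Finset α))
          (p.2 ⟨x, mem_second h⟩ : Finset α) := by
  simp only [fwd, dif_pos h]

theorem fwd_neg (Q S : Finset (Finset α)) (Ia Jc : Finset α)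
    (p : Σ ι : {x // x ∈ Ia} → {J // J ∈ Q},
      ({y // y ∈ Jc ∪ fiber Ia (fun x => (ι x : Finset α)) Jc} → {Kk // Kk ∈ S}))
    (x : {x // x ∈ Ia}) (h : (p.1 x : Finset α) ≠ Jc) :
    ((fwd Q S Ia Jc p).2 x : Finset α) = p.1 x := by
  simp only [fwd, dif_neg h]

theorem fwd_inj (Q S : Finset (Finset α)) (hS : IsPartition S)
    (hQS : Disjoint (supp Q) (supp S)) (Ia Jc : Finset α) (hJc : Jc ∈ Q) :
    Function.Injective (fwd Q S Ia Jc) := by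
  intro p q hpq
  have e1 : ∀ y, (fwd Q S Ia Jc p).1 y = (fwd Q S Ia Jc q).1 y := by rw [hpq]; simp
  have e2 : ∀ x, ((fwd Q S Ia Jc p).2 x : Finset α) = (fwd Q S Ia Jc q).2 x := by
    rw [hpq]; simp
  have h1 : ∀ x, p.1 x = q.1 x := by
    intro x
    have := e2 x
    apply Subtype.ext
    by_cases hp : (p.1 x : Finset α) = Jc <;> by_cases hq : (q.1 x : Finset α) = Jc
    · rw [hp, hq]
    · rw [fwd_pos _ _ _ _ _ _ hp, fwd_neg _ _ _ _ _ _ hq] at this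
      exact (ne_union hS hQS (q.1 x).2 (p.2 _).2 _ this.symm).elim
    · rw [fwd_neg _ _ _ _ _ _ hp, fwd_pos _ _ _ _ _ _ hq] at this
      exact (ne_union hS hQS (p.1 x).2 (q.2 _).2 _ this).elim
    · rwa [fwd_neg _ _ _ _ _ _ hp, fwd_neg _ _ _ _ _ _ hq] at this
  refine src_ext p q h1 ?_
  intro y hy hy'
  by_cases hyJ : y ∈ Jc
  · exact e1 ⟨y, hyJ⟩
  · obtain ⟨hI, hp⟩ := mem_fiber'.1 ((Finset.mem_union.1 hy).resolve_left hyJ)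
    obtain ⟨_, hq⟩ := mem_fiber'.1 ((Finset.mem_union.1 hy').resolve_left hyJ)
    have := e2 ⟨y, hI⟩
    rw [fwd_pos _ _ _ _ _ _ hp, fwd_pos _ _ _ _ _ _ hq] at this
    exact Subtype.ext (union_inj hS hQS hJc (p.2 _).2 (q.2 _).2 this)

theorem fwd_surj (P Q S : Finset (Finset α))
    (hPQ : Disjoint (supp P) (supp Q)) (Ia Jc : Finset α) (hIa : Ia ∈ P) (hJc : Jc ∈ Q) :
    Function.Surjective (fwd Q S Ia Jc) := by
  rintro ⟨μ, ι⟩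
  have hex : ∀ x : {x // x ∈ Ia}, ¬ ((ι x : Finset α) ≠ Jc ∧ (ι x : Finset α) ∈ Q) →
      ∃ K : {K // K ∈ S}, (K : Finset α) ∪ fiber Jc (fun y => (μ y : Finset α)) K = ι x := by
    intro x hx
    obtain ⟨K, hK, h⟩ := (mem_ins'.1 (ι x).2).resolve_left hx
    exact ⟨⟨K, hK⟩, h⟩
  choose k hk using hex
  let ι0 : {x // x ∈ Ia} → {J // J ∈ Q} := fun x =>
    if h : (ι x : Finset α) ≠ Jc ∧ (ι x : Finset α) ∈ Q then ⟨ι x, h.2⟩ else ⟨Jc, hJc⟩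
  have hpos : ∀ x, (ι x : Finset α) ≠ Jc ∧ (ι x : Finset α) ∈ Q → (ι0 x : Finset α) = ι x := by
    intro x h
    simp only [ι0, dif_pos h]
  have hcond : ∀ x, (ι0 x : Finset α) = Jc → ¬ ((ι x : Finset α) ≠ Jc ∧ (ι x : Finset α) ∈ Q) := by
    intro x hx h
    rw [hpos x h] at hx
    exact h.1 hx
  have hcond2 : ∀ x, (ι0 x : Finset α) ≠ Jc → ((ι x : Finset α) ≠ Jc ∧ (ι x : Finset α) ∈ Q) := by
    intro x hx
    by_contra h
    apply hx
    simp only [ι0, dif_neg h]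
  have hm : ∀ y, y ∈ Jc ∪ fiber Ia (fun x => (ι0 x : Finset α)) Jc → y ∉ Jc →
      ∃ h : y ∈ Ia, (ι0 ⟨y, h⟩ : Finset α) = Jc := fun y hy hyJ =>
    mem_fiber'.1 ((Finset.mem_union.1 hy).resolve_left hyJ)
  let μ0 : {y // y ∈ Jc ∪ fiber Ia (fun x => (ι0 x : Finset α)) Jc} → {Kk // Kk ∈ S} := fun y =>
    if h : (y : α) ∈ Jc then μ ⟨y, h⟩ else
      k ⟨y, (hm y y.2 h).1⟩ (hcond _ (hm y y.2 h).2)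
  have h1 : ∀ y, (fwd Q S Ia Jc ⟨ι0, μ0⟩).1 y = μ y := by
    intro y
    simp only [fwd, μ0, dif_pos y.2]
  refine ⟨⟨ι0, μ0⟩, tgt_ext _ _ h1 ?_⟩
  intro x
  by_cases hx : (ι0 x : Finset α) = Jc
  · rw [fwd_pos _ _ _ _ _ _ hx]
    have hxJ : (x : α) ∉ Jc := fun h => not_mem_of_disj hPQ hIa hJc x.2 h
    have h3 : μ0 ⟨x, mem_second hx⟩ = k x (hcond x hx) := by
      simp only [μ0, dif_neg hxJ]
    simp only [h1]
    rw [h3]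
    exact hk x _
  · rw [fwd_neg _ _ _ _ _ _ hx]
    exact hpos x (hcond2 x hx)

theorem fwd_ins (P Q S : Finset (Finset α))
    (hQ : IsPartition Q) (hS : IsPartition S)
    (hPQ : Disjoint (supp P) (supp Q))
    (hQS : Disjoint (supp Q) (supp S))
    (Ia : Finset α) (hIa : Ia ∈ P) (Jc : Finset α) (hJc : Jc ∈ Q)
    (p : Σ ι : {x // x ∈ Ia} → {J // J ∈ Q},
      ({y // y ∈ Jc ∪ fiber Ia (fun x => (ι x : Finset α)) Jc} → {Kk // Kk ∈ S})) :
    ins (ins P Ia Q p.1) (Jc ∪ fiber Ia (fun x => (p.1 x : Finset α)) Jc) S p.2 =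
      ins P Ia (ins Q Jc S (fwd Q S Ia Jc p).1) (fwd Q S Ia Jc p).2 := by
  have hA : ∀ J ∈ Q, J ≠ Jc → fiber Ia (fun x => ((fwd Q S Ia Jc p).2 x : Finset α)) J =
      fiber Ia (fun x => (p.1 x : Finset α)) J := by
    intro J hJ hne
    ext z
    rw [mem_fiber', mem_fiber']
    refine exists_congr fun hz => ?_
    by_cases hx : (p.1 ⟨z, hz⟩ : Finset α) = Jc
    · rw [fwd_pos _ _ _ _ _ _ hx, hx]
      exact ⟨fun h => (ne_union hS hQS hJ (p.2 _).2 _ h.symm).elim, fun h => (hne h.symm).elim⟩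
    · rw [fwd_neg _ _ _ _ _ _ hx]
  have hB : ∀ K ∈ S, (K ∪ fiber Jc (fun y => ((fwd Q S Ia Jc p).1 y : Finset α)) K) ∪
      fiber Ia (fun x => ((fwd Q S Ia Jc p).2 x : Finset α))
        (K ∪ fiber Jc (fun y => ((fwd Q S Ia Jc p).1 y : Finset α)) K) =
      K ∪ fiber _ (fun y => (p.2 y : Finset α)) K := by
    intro K hK
    rw [Finset.union_assoc]
    congr 1
    ext z
    rw [Finset.mem_union, mem_fiber', mem_fiber', mem_fiber']
    constructor
    · rintro (⟨hz, h⟩ | ⟨hz, h⟩)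
      · exact ⟨Finset.mem_union_left _ hz, h⟩
      · by_cases hx : (p.1 ⟨z, hz⟩ : Finset α) = Jc
        · rw [fwd_pos _ _ _ _ _ _ hx] at h
          exact ⟨mem_second hx, union_inj hS hQS hJc (p.2 _).2 hK h⟩
        · rw [fwd_neg _ _ _ _ _ _ hx] at h
          exact (ne_union hS hQS (p.1 _).2 hK _ h).elim
    · rintro ⟨hz, h⟩
      by_cases hzJ : z ∈ Jc
      · exact Or.inl ⟨hzJ, h⟩
      · obtain ⟨hI, hp⟩ := mem_fiber'.1 ((Finset.mem_union.1 hz).resolve_left hzJ)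
        refine Or.inr ⟨hI, ?_⟩
        rw [fwd_pos _ _ _ _ _ _ hp, h]
  have hC : ∀ J ∈ Q, J ≠ Jc → J ∪ fiber Ia (fun x => (p.1 x : Finset α)) J ≠
      Jc ∪ fiber Ia (fun x => (p.1 x : Finset α)) Jc := by
    intro J hJ hne h
    obtain ⟨z, hz⟩ := hQ.1 J hJ
    have hz2 : z ∈ Jc ∪ fiber Ia (fun x => (p.1 x : Finset α)) Jc :=
      h ▸ Finset.mem_union_left _ hz
    rcases Finset.mem_union.1 hz2 with h1 | h1
    · exact hne (part_eq hQ hJ hJc hz h1)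
    · exact not_mem_of_disj hPQ hIa hJ (mem_fiber'.1 h1).1 hz
  have hD : ∀ T ∈ P, T ≠ Jc ∪ fiber Ia (fun x => (p.1 x : Finset α)) Jc := fun T hT =>
    ne_union hQ hPQ hT hJc _
  ext T
  rw [mem_ins', mem_ins', mem_ins']
  constructor
  · rintro (⟨hT, h | ⟨J, hJ, rfl⟩⟩ | ⟨K, hK, rfl⟩)
    · exact Or.inl h
    · have hne : J ≠ Jc := by
        rintro rfl
        exact hT rfl
      exact Or.inr ⟨J, mem_ins'.2 (Or.inl ⟨hne, hJ⟩), by rw [hA J hJ hne]⟩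
    · exact Or.inr ⟨_, mem_ins'.2 (Or.inr ⟨K, hK, rfl⟩), hB K hK⟩
  · rintro (h | ⟨L, hL, rfl⟩)
    · exact Or.inl ⟨hD T h.2, Or.inl h⟩
    · rcases mem_ins'.1 hL with ⟨hne, hJ⟩ | ⟨K, hK, rfl⟩
      · rw [hA L hJ hne]
        exact Or.inl ⟨hC L hJ hne, Or.inr ⟨L, hJ, rfl⟩⟩
      · exact Or.inr ⟨K, hK, (hB K hK).symm⟩

/-- the assignment `(ι, μ_J) ↦ (μ', ι')` — determined by
`μ' = μ_J|_{J_c}`, `ι'|_{I_a \ ι⁻¹(J_c)} = ι`, and `ι'(x) = μ_J(x)` (as the member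
`K ∪ μ'⁻¹(K)` of `Q ∘_c^{μ'} S` with `K = μ_J(x)`) for `x ∈ ι⁻¹(J_c)` — is a
bijection between pairs `(ι : I_a → Q, μ_J : J_c ∪ ι⁻¹(J_c) → S)` and pairs
`(μ' : J_c → S, ι' : I_a → Q ∘_c^{μ'} S)`, and it satisfies
`(P ∘_a^ι Q) ∘^{μ_J} S = P ∘_a^{ι'} (Q ∘_c^{μ'} S)`, the insertion `∘^{μ_J}` being
performed at the member `J_c ∪ ι⁻¹(J_c)` of `P ∘_a^ι Q`. -/
theorem ins_assoc_bijection (P Q S : Finset (Finset α))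
    (hP : IsPartition P) (hQ : IsPartition Q) (hS : IsPartition S)
    (hPQ : Disjoint (supp P) (supp Q)) (hPS : Disjoint (supp P) (supp S))
    (hQS : Disjoint (supp Q) (supp S))
    (Ia : Finset α) (hIa : Ia ∈ P) (Jc : Finset α) (hJc : Jc ∈ Q) :
    ∃ e : (Σ ι : {x // x ∈ Ia} → {J // J ∈ Q},
            ({y // y ∈ Jc ∪ fiber Ia (fun x => (ι x : Finset α)) Jc} → {Kk // Kk ∈ S})) ≃
          (Σ μ' : {y // y ∈ Jc} → {Kk // Kk ∈ S},
            ({x // x ∈ Ia} → {J // J ∈ ins Q Jc S μ'})),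
      ∀ p : (Σ ι : {x // x ∈ Ia} → {J // J ∈ Q},
            ({y // y ∈ Jc ∪ fiber Ia (fun x => (ι x : Finset α)) Jc} → {Kk // Kk ∈ S})),
        (∀ y : {y // y ∈ Jc},
          ((e p).1 y : Finset α)
            = (p.2 ⟨(y : α), Finset.mem_union_left _ y.2⟩ : Finset α)) ∧
        (∀ x : {x // x ∈ Ia}, (p.1 x : Finset α) ≠ Jc →
          ((e p).2 x : Finset α) = (p.1 x : Finset α)) ∧
        (∀ x : {x // x ∈ Ia}, ∀ h : (p.1 x : Finset α) = Jc,
          have hm : (x : α) ∈ Jc ∪ fiber Ia (fun z => (p.1 z : Finset α)) Jc :=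
            Finset.mem_union_right _ (by
              simp only [fiber, Finset.mem_image, Finset.mem_filter,
                Finset.mem_attach, true_and]
              exact ⟨x, h, rfl⟩)
          ((e p).2 x : Finset α)
            = (p.2 ⟨(x : α), hm⟩ : Finset α) ∪
                fiber Jc (fun y => ((e p).1 y : Finset α))
                  (p.2 ⟨(x : α), hm⟩ : Finset α)) ∧
        ins (ins P Ia Q p.1) (Jc ∪ fiber Ia (fun x => (p.1 x : Finset α)) Jc) S p.2 =
          ins P Ia (ins Q Jc S (e p).1) (e p).2 := by
  refine ⟨Equiv.ofBijective (fwd Q S Ia Jc)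
    ⟨fwd_inj Q S hS hQS Ia Jc hJc, fwd_surj P Q S hPQ Ia Jc hIa hJc⟩, fun p => ?_⟩
  exact ⟨fun _ => rfl, fun x h => fwd_neg Q S Ia Jc p x h, fun x h => fwd_pos Q S Ia Jc p x h,
    fwd_ins P Q S hQ hS hPQ hQS Ia hIa Jc hJc p⟩

end PartitionOps
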